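/- arXiv:1505.05574 — 8 statements merged into one kernel-verified Lean document; each statement's English description precedes it below -/
import Mathlib

section
/- Let A be a ring and let Q₁, ..., Qₙ be completely nilary (two-sided) ideals of A such that Qₖˢ ⊆ Q₁ ∩ ⋯ ∩ Qₙ for some fixed index k with 1 ≤ k ≤ n and some positive integer s. Then the product ideal Q₁⋯Qₙ is a completely nilary ideal of A. -/
/-!
Common definitions.

All rings are associative but not necessarily commutative and not necessarily unital,
so we work with `NonUnitalRing` and `TwoSidedIdeal`.

Since a non-unital ring has no `a ^ 0`, positive powers/products are indexed with a shift:
the index `n : ℕ` always corresponds to the positive exponent/length `n + 1`.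
-/

/-- `posPow a n` is the positive power `a ^ (n + 1)` of `a`. -/
def posPow {A : Type*} [NonUnitalRing A] (a : A) : ℕ → A
  | 0 => a
  | n + 1 => posPow a n * a

/-- An element of a (possibly non-unital) ring is nilpotent if
some positive power of it is `0`. -/
def IsNilpotentElem {A : Type*} [NonUnitalRing A] (a : A) : Prop :=
  ∃ n : ℕ, posPow a n = 0

/-- `IsProdLen S n x` means that `x` is a product of `n + 1` elements of `S`
(multiplied in order, which suffices by associativity). -/
inductive IsProdLen {A : Type*} [NonUnitalRing A] (S : Set A) : ℕ → A → Prop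
  | single {a : A} : a ∈ S → IsProdLen S 0 a
  | mul {a x : A} {n : ℕ} : a ∈ S → IsProdLen S n x → IsProdLen S (n + 1) (a * x)

/-- The containment `J * K ⊆ I` of two-sided ideals, expressed elementwise
(this is equivalent, since `J * K` is the additive closure of the set of
products and `I` is closed under addition). -/
def ProdLE {A : Type*} [NonUnitalRing A] (J K I : TwoSidedIdeal A) : Prop :=
  ∀ x ∈ J, ∀ y ∈ K, x * y ∈ I

/-- `J * K = 0` for two-sided ideals `J`, `K`, expressed elementwise. -/
def ProdEqZero {A : Type*} [NonUnitalRing A] (J K : TwoSidedIdeal A) : Prop :=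
  ∀ x ∈ J, ∀ y ∈ K, x * y = 0

/-- The containment `J ^ (m + 1) ⊆ I`, expressed elementwise. -/
def PowLE {A : Type*} [NonUnitalRing A] (J : TwoSidedIdeal A) (m : ℕ)
    (I : TwoSidedIdeal A) : Prop :=
  ∀ x : A, IsProdLen (J : Set A) m x → x ∈ I

/-- `J ^ (m + 1) = 0`, expressed elementwise; so `∃ m, PowEqZero J m` says that
`J` is a nilpotent ideal. -/
def PowEqZero {A : Type*} [NonUnitalRing A] (J : TwoSidedIdeal A) (m : ℕ) : Prop :=
  ∀ x : A, IsProdLen (J : Set A) m x → x = 0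

/-- `I` is a completely nilary ideal: whenever `a * b ∈ I`, some positive power of `a`
or some positive power of `b` lies in `I`. -/
def IsCompletelyNilaryIdeal {A : Type*} [NonUnitalRing A] (I : TwoSidedIdeal A) : Prop :=
  ∀ a b : A, a * b ∈ I → (∃ n : ℕ, posPow a n ∈ I) ∨ (∃ m : ℕ, posPow b m ∈ I)

/-- `A` is a completely nilary ring: whenever `a * b = 0`, `a` is nilpotent or
`b` is nilpotent. -/
def IsCompletelyNilaryRing (A : Type*) [NonUnitalRing A] : Prop :=
  ∀ a b : A, a * b = 0 → IsNilpotentElem a ∨ IsNilpotentElem b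

/-- `I` is a nilary ideal: whenever `J * K ⊆ I` for two-sided ideals `J`, `K`, some
positive power of `J` or of `K` is contained in `I`. -/
def IsNilaryIdeal {A : Type*} [NonUnitalRing A] (I : TwoSidedIdeal A) : Prop :=
  ∀ J K : TwoSidedIdeal A, ProdLE J K I →
    (∃ m : ℕ, PowLE J m I) ∨ (∃ n : ℕ, PowLE K n I)

/-- `A` is a nilary ring: whenever `J * K = 0` for two-sided ideals `J`, `K`, then `J`
or `K` is nilpotent. -/
def IsNilaryRing (A : Type*) [NonUnitalRing A] : Prop :=
  ∀ J K : TwoSidedIdeal A, ProdEqZero J K →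
    (∃ m : ℕ, PowEqZero J m) ∨ (∃ n : ℕ, PowEqZero K n)

/-- `I` is a p-nilary ideal: the nilary condition for principal two-sided ideals. -/
def IsPNilaryIdeal {A : Type*} [NonUnitalRing A] (I : TwoSidedIdeal A) : Prop :=
  ∀ a b : A, ProdLE (TwoSidedIdeal.span {a}) (TwoSidedIdeal.span {b}) I →
    (∃ m : ℕ, PowLE (TwoSidedIdeal.span {a}) m I) ∨
    (∃ n : ℕ, PowLE (TwoSidedIdeal.span {b}) n I)

/-- `A` is a p-nilary ring: whenever `J * K = 0` for principal two-sided ideals `J`, `K`,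
then `J` or `K` is nilpotent. -/
def IsPNilaryRing (A : Type*) [NonUnitalRing A] : Prop :=
  ∀ a b : A, ProdEqZero (TwoSidedIdeal.span {a}) (TwoSidedIdeal.span {b}) →
    (∃ m : ℕ, PowEqZero (TwoSidedIdeal.span {a}) m) ∨
    (∃ n : ℕ, PowEqZero (TwoSidedIdeal.span {b}) n)

/-- `I` is a weakly nilary ideal: `I` is proper, and whenever `0 ≠ J * K ⊆ I` for two-sided
ideals `J`, `K`, some positive power of `J` or of `K` is contained in `I`. -/
def IsWeaklyNilaryIdeal {A : Type*} [NonUnitalRing A] (I : TwoSidedIdeal A) : Prop :=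
  I ≠ ⊤ ∧ ∀ J K : TwoSidedIdeal A, ¬ ProdEqZero J K → ProdLE J K I →
    (∃ m : ℕ, PowLE J m I) ∨ (∃ n : ℕ, PowLE K n I)

/-- `seqProd a k = a 0 * a 1 * ⋯ * a k`, the ordered product of the first `k + 1`
values of `a`. -/
def seqProd {A : Type*} [NonUnitalRing A] (a : ℕ → A) : ℕ → A
  | 0 => a 0
  | k + 1 => seqProd a k * a (k + 1)

theorem posPow_mul_posPow {A : Type*} [NonUnitalRing A] (a : A) (m p : ℕ) :
    posPow a m * posPow a p = posPow a (m + p + 1) := by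
  induction p with
  | zero => rfl
  | succ p ih =>
    change posPow a m * (posPow a p * a) = posPow a (m + p + 1) * a
    rw [← mul_assoc, ih]

theorem exists_posPow_posPow_eq {A : Type*} [NonUnitalRing A] (a : A) (m p : ℕ) :
    ∃ q, posPow (posPow a m) p = posPow a q := by
  induction p with
  | zero => exact ⟨m, rfl⟩
  | succ p ih =>
    obtain ⟨q, hq⟩ := ih
    exact ⟨q + m + 1, by rw [posPow, hq, posPow_mul_posPow]⟩

theorem isProdLen_posPow {A : Type*} [NonUnitalRing A] {S : Set A} {a : A} (ha : a ∈ S)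
    (n : ℕ) : IsProdLen S n (posPow a n) := by
  induction n with
  | zero => exact .single ha
  | succ n ih =>
    have h : posPow a (n + 1) = a * posPow a n := by
      simpa [posPow] using (posPow_mul_posPow a 0 n).symm
    exact h ▸ .mul ha ih

theorem seqProd_const {A : Type*} [NonUnitalRing A] (a : A) (n : ℕ) :
    seqProd (fun _ => a) n = posPow a n := by
  induction n with
  | zero => rfl
  | succ n ih => rw [seqProd, posPow, ih]

theorem seqProd_mem {A : Type*} [NonUnitalRing A] (I : TwoSidedIdeal A) {a : ℕ → A} {k n : ℕ}
    (hkn : k ≤ n) (hk : a k ∈ I) : seqProd a n ∈ I := by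
  induction n with
  | zero =>
    obtain rfl := Nat.le_zero.mp hkn
    exact hk
  | succ n ih =>
    rcases Nat.le_succ_iff.mp hkn with h | rfl
    · exact I.mul_mem_right _ _ (ih h)
    · exact I.mul_mem_left _ _ hk

/-- Let `Q 0, …, Q (n-1)` (with `n ≥ 1`) be completely nilary two-sided
ideals of `A` such that `(Q k) ^ (s + 1) ⊆ Q 0 ∩ ⋯ ∩ Q (n-1)` for some fixed `k < n` and
some positive integer `s + 1`.  Then the product ideal `Q 0 ⋯ Q (n-1)` — which, since each
`Q i` is a two-sided ideal, coincides with the two-sided ideal generated by the ordered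
products `a 0 * ⋯ * a (n-1)` with `a i ∈ Q i` — is a completely nilary ideal of `A`. -/
theorem prod_isCompletelyNilary {A : Type*} [NonUnitalRing A] (n : ℕ) (hn : 0 < n)
    (Q : ℕ → TwoSidedIdeal A) (hQ : ∀ i < n, IsCompletelyNilaryIdeal (Q i))
    (k : ℕ) (hk : k < n) (s : ℕ)
    (hs : ∀ x : A, IsProdLen (Q k : Set A) s x → ∀ i < n, x ∈ Q i) :
    IsCompletelyNilaryIdeal
      (TwoSidedIdeal.span
        {x : A | ∃ a : ℕ → A, (∀ i < n, a i ∈ Q i) ∧ x = seqProd a (n - 1)}) := by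
  have power_mem : ∀ c : A, (∃ m, posPow c m ∈ Q k) → ∃ m, posPow c m ∈ TwoSidedIdeal.span
      {x : A | ∃ a : ℕ → A, (∀ i < n, a i ∈ Q i) ∧ x = seqProd a (n - 1)} := by
    rintro c ⟨m, hm⟩
    obtain ⟨p, hp⟩ := exists_posPow_posPow_eq c m s
    obtain ⟨q, hq⟩ := exists_posPow_posPow_eq c p (n - 1)
    have h_mem := hs _ (isProdLen_posPow hm s)
    rw [hp] at h_mem
    exact ⟨q, TwoSidedIdeal.subset_span
      ⟨fun _ => posPow c p, h_mem, by rw [seqProd_const, hq]⟩⟩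
  intro a b hab
  have h_le : TwoSidedIdeal.span
      {x : A | ∃ a : ℕ → A, (∀ i < n, a i ∈ Q i) ∧ x = seqProd a (n - 1)} ≤ Q k := by
    rw [TwoSidedIdeal.span_le]
    rintro _ ⟨x, hx, rfl⟩
    exact seqProd_mem (Q k) (Nat.le_sub_one_of_lt hk) (hx k hk)
  exact (hQ k hk a b (h_le hab)).imp (power_mem a) (power_mem b)
end

section
/- Let φ : A → Ā be a surjective ring homomorphism and let I be a two-sided ideal of A with ker(φ) ⊆ I. If I is a completely nilary ideal of A, then φ(I) is a completely nilary ideal of Ā. -/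
theorem map_posPow {A B : Type*} [NonUnitalRing A] [NonUnitalRing B] (phi : A →ₙ+* B) (a : A)
    (n : ℕ) : phi (posPow a n) = posPow (phi a) n := by
  induction n with
  | zero => rfl
  | succ n ih => simp only [posPow, map_mul, ih]

theorem TwoSidedIdeal.mem_map_iff_of_surjective {A B : Type*} [NonUnitalRing A] [NonUnitalRing B]
    (phi : A →ₙ+* B) (hphi : Function.Surjective phi) (I : TwoSidedIdeal A) {y : B} :
    y ∈ TwoSidedIdeal.map phi I ↔ ∃ x ∈ I, phi x = y := by
  refine ⟨fun hy => ?_, ?_⟩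
  · induction hy using TwoSidedIdeal.span_induction with
    | mem x hx => exact hx
    | zero => exact ⟨0, I.zero_mem, map_zero phi⟩
    | add x y _ _ hx hy =>
      obtain ⟨a, ha, rfl⟩ := hx
      obtain ⟨b, hb, rfl⟩ := hy
      exact ⟨a + b, I.add_mem ha hb, map_add phi a b⟩
    | neg x _ hx =>
      obtain ⟨a, ha, rfl⟩ := hx
      exact ⟨-a, I.neg_mem ha, map_neg phi a⟩
    | left_absorb r x _ hx =>
      obtain ⟨a, ha, rfl⟩ := hx
      obtain ⟨b, rfl⟩ := hphi r
      exact ⟨b * a, I.mul_mem_left b a ha, map_mul phi b a⟩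
    | right_absorb r x _ hx =>
      obtain ⟨a, ha, rfl⟩ := hx
      obtain ⟨b, rfl⟩ := hphi r
      exact ⟨a * b, I.mul_mem_right a b ha, map_mul phi a b⟩
  · rintro ⟨x, hx, rfl⟩
    exact TwoSidedIdeal.subset_span ⟨x, hx, rfl⟩

theorem TwoSidedIdeal.apply_mem_map_iff {A B : Type*} [NonUnitalRing A] [NonUnitalRing B]
    (phi : A →ₙ+* B) (hphi : Function.Surjective phi) (I : TwoSidedIdeal A)
    (hker : ∀ x : A, phi x = 0 → x ∈ I) {a : A} :
    phi a ∈ TwoSidedIdeal.map phi I ↔ a ∈ I := by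
  rw [TwoSidedIdeal.mem_map_iff_of_surjective phi hphi]
  refine ⟨?_, fun ha => ⟨a, ha, rfl⟩⟩
  rintro ⟨x, hx, hxa⟩
  have h := I.add_mem (hker (a - x) (by rw [map_sub, hxa, sub_self])) hx
  rwa [sub_add_cancel] at h

/-- If `φ : A → Ā` is a surjective ring homomorphism, `I` is a two-sided
ideal of `A` containing `ker φ`, and `I` is completely nilary, then `φ(I)` (the two-sided
ideal of `Ā` generated by the image of `I`, which is the image itself since `φ` is
surjective) is a completely nilary ideal of `Ā`. -/
theorem map_isCompletelyNilary {A B : Type*} [NonUnitalRing A] [NonUnitalRing B]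
    (phi : A →ₙ+* B) (hphi : Function.Surjective phi) (I : TwoSidedIdeal A)
    (hker : ∀ x : A, phi x = 0 → x ∈ I) (hI : IsCompletelyNilaryIdeal I) :
    IsCompletelyNilaryIdeal (TwoSidedIdeal.map phi I) := by
  intro x y hxy
  obtain ⟨a, rfl⟩ := hphi x
  obtain ⟨b, rfl⟩ := hphi y
  simp only [← map_mul, ← map_posPow, TwoSidedIdeal.apply_mem_map_iff phi hphi I hker] at hxy ⊢
  exact hI a b hxy
end

section
/- Let A be a ring and I a two-sided ideal of A such that the quotient ring A/I is commutative. Then I is a p-nilary ideal of A if and only if I is a completely nilary ideal of A. -/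
theorem posPow_succ_eq_mul_posPow {A : Type*} [NonUnitalRing A] (a : A) (n : ℕ) :
    posPow a (n + 1) = a * posPow a n := by
  induction n with
  | zero => rfl
  | succ n ih =>
    calc posPow a (n + 1) * a = a * posPow a n * a := by rw [ih]
      _ = a * posPow a (n + 1) := mul_assoc _ _ _

namespace TwoSidedIdeal

variable {A : Type*} [NonUnitalRing A] {I : TwoSidedIdeal A}

theorem mul_comm_mem (h : ∀ x y : A, x * y - y * x ∈ I) {x y : A} (hxy : x * y ∈ I) :
    y * x ∈ I := by
  simpa using I.add_mem (h y x) hxy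

/-- The ideal of all `x` with `x * b ∈ I`, when `I` contains all commutators. -/
def colonElem (h : ∀ x y : A, x * y - y * x ∈ I) (b : A) : TwoSidedIdeal A :=
  .mk' {x | x * b ∈ I}
    (by simp [I.zero_mem])
    (fun {x y} hx hy => by
      simpa [add_mul] using I.add_mem hx hy)
    (fun {x} hx => by
      simpa using I.neg_mem hx)
    (fun {x y} hy => by
      simpa [mul_assoc] using I.mul_mem_left x _ hy)
    (fun {x y} hx => by
      have hx' : b * x ∈ I := mul_comm_mem h hx
      have hb : b * (x * y) ∈ I := by
        simpa [mul_assoc] using I.mul_mem_right _ y hx'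
      exact mul_comm_mem h hb)

theorem mem_colonElem (h : ∀ x y : A, x * y - y * x ∈ I) {b x : A} :
    x ∈ colonElem h b ↔ x * b ∈ I := by
  simp [colonElem]

theorem mul_mem_of_mem_span_singleton (h : ∀ x y : A, x * y - y * x ∈ I) {a b x : A}
    (hab : a * b ∈ I) (hx : x ∈ span {a}) : x * b ∈ I :=
  (mem_colonElem h).1 <|
    mem_span_iff.1 hx _ (Set.singleton_subset_iff.2 ((mem_colonElem h).2 hab))

theorem prodLE_span_singleton (h : ∀ x y : A, x * y - y * x ∈ I) {a b : A}
    (hab : a * b ∈ I) : ProdLE (span {a}) (span {b}) I := fun _ hx _ hy =>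
  mul_comm_mem h <| mul_mem_of_mem_span_singleton h
    (mul_comm_mem h (mul_mem_of_mem_span_singleton h hab hx)) hy

theorem powLE_span_singleton {a : A} (n : ℕ) {I : TwoSidedIdeal A}
    (h : ∀ x y : A, x * y - y * x ∈ I) (ha : posPow a n ∈ I) : PowLE (span {a}) n I := by
  induction n generalizing I with
  | zero =>
    rintro _ ⟨hx⟩
    exact mem_span_iff.1 hx I (Set.singleton_subset_iff.2 ha)
  | succ n ih =>
    rintro _ (_ | ⟨hy, hx⟩)
    have hcolon : ∀ x y : A, x * y - y * x ∈ colonElem h a := fun x y =>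
      (mem_colonElem h).2 (I.mul_mem_right _ a (h x y))
    have hxa := (mem_colonElem h).1 (ih hcolon ((mem_colonElem h).2 ha) _ hx)
    exact mul_mem_of_mem_span_singleton h (mul_comm_mem h hxa) hy

end TwoSidedIdeal

/-- Let `I` be a two-sided ideal of `A` such that the quotient ring
`A / I` is commutative.  Then `I` is a p-nilary ideal iff `I` is a completely nilary
ideal. -/
theorem pNilary_iff_completelyNilary_of_quotient_comm
    {A : Type*} [NonUnitalRing A] (I : TwoSidedIdeal A)
    (hcomm : ∀ x y : I.ringCon.Quotient, x * y = y * x) :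
    IsPNilaryIdeal I ↔ IsCompletelyNilaryIdeal I := by
  have h : ∀ x y : A, x * y - y * x ∈ I := fun x y => by
    rw [← TwoSidedIdeal.rel_iff]
    exact I.ringCon.eq.1 (hcomm x y)
  constructor
  · intro hI a b hab
    have mem_span_self (c : A) : c ∈ (TwoSidedIdeal.span {c} : TwoSidedIdeal A) :=
      TwoSidedIdeal.subset_span rfl
    exact (hI a b (TwoSidedIdeal.prodLE_span_singleton h hab)).imp
      (fun ⟨m, hm⟩ => ⟨m, hm _ (isProdLen_posPow (mem_span_self a) m)⟩)
      (fun ⟨n, hn⟩ => ⟨n, hn _ (isProdLen_posPow (mem_span_self b) n)⟩)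
  · intro hI a b hab
    exact (hI a b (hab a (TwoSidedIdeal.subset_span rfl) b (TwoSidedIdeal.subset_span rfl))).imp
      (fun ⟨m, hm⟩ => ⟨m, TwoSidedIdeal.powLE_span_singleton m h hm⟩)
      (fun ⟨n, hn⟩ => ⟨n, TwoSidedIdeal.powLE_span_singleton n h hn⟩)
end

section
/- Let A be a ring. If A is a completely nilary ring in which every nil (two-sided) ideal is nilpotent, then A is a nilary ring. -/
/-- If `A` is a completely nilary ring in which every nil two-sided
ideal is nilpotent, then `A` is a nilary ring. -/
theorem nilaryRing_of_completelyNilary_of_nil_imp_nilpotent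
    {A : Type*} [NonUnitalRing A] (h1 : IsCompletelyNilaryRing A)
    (h2 : ∀ J : TwoSidedIdeal A, (∀ x ∈ J, IsNilpotentElem x) → ∃ m : ℕ, PowEqZero J m) :
    IsNilaryRing A := by
  intro J K hJK
  by_cases hJ : ∀ x ∈ J, IsNilpotentElem x
  · exact Or.inl (h2 J hJ)
  · push Not at hJ
    obtain ⟨a, haJ, ha⟩ := hJ
    exact Or.inr (h2 K fun b hb => (h1 a b (hJK a haJ b hb)).resolve_left ha)
end

section
/- Let A be a completely nilary ring. If A is left (or right) Artinian, then A is a nilary ring. -/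
theorem posPow_eq_pow {A : Type*} [Ring A] (a : A) (n : ℕ) : posPow a n = a ^ (n + 1) := by
  induction n with
  | zero => simp [posPow]
  | succ n ih => rw [posPow, ih, ← pow_succ]

theorem isNilpotentElem_iff_isNilpotent {A : Type*} [Ring A] {a : A} :
    IsNilpotentElem a ↔ IsNilpotent a := by
  simp only [IsNilpotentElem, posPow_eq_pow]
  exact ⟨fun ⟨n, hn⟩ ↦ ⟨n + 1, hn⟩, fun ⟨n, hn⟩ ↦ ⟨n, pow_eq_zero_of_le n.le_succ hn⟩⟩

/-- A nil left ideal is contained in the Jacobson radical. -/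
theorem Ideal.le_jacobson_bot_of_forall_isNilpotent {R : Type*} [Ring R] {I : Ideal R}
    (hI : ∀ x ∈ I, IsNilpotent x) : I ≤ Ideal.jacobson ⊥ := by
  refine fun x hx ↦ Ideal.mem_jacobson_iff.mpr fun y ↦ ?_
  obtain ⟨z, hz⟩ := (hI _ (I.mul_mem_left y hx)).isUnit_add_one.exists_left_inv
  refine ⟨z, ?_⟩
  rw [Ideal.mem_bot, mul_assoc, ← mul_add_one, hz, sub_self]

theorem IsArtinianRing.isNilpotent_of_forall_isNilpotent {R : Type*} [Ring R] [IsArtinianRing R]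
    {I : Ideal R} (hI : ∀ x ∈ I, IsNilpotent x) : IsNilpotent I := by
  obtain ⟨n, hn⟩ := IsArtinianRing.isNilpotent_jacobson_bot (R := R)
  refine ⟨n, le_bot_iff.mp ?_⟩
  exact (Ideal.pow_right_mono (Ideal.le_jacobson_bot_of_forall_isNilpotent hI) n).trans hn.le

theorem IsProdLen.mem_pow_asIdeal {A : Type*} [Ring A] {J : TwoSidedIdeal A} {n : ℕ} {x : A}
    (hx : IsProdLen (J : Set A) n x) : x ∈ J.asIdeal ^ (n + 1) := by
  induction hx with
  | single ha => simpa [Submodule.pow_one] using ha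
  | mul ha _ ih =>
    rw [Ideal.IsTwoSided.pow_succ]
    exact Ideal.mul_mem_mul (TwoSidedIdeal.mem_asIdeal.mpr ha) ih

theorem IsProdLen.op_mem_pow_asIdealOpposite {A : Type*} [Ring A] {J : TwoSidedIdeal A} {n : ℕ}
    {x : A} (hx : IsProdLen (J : Set A) n x) :
    MulOpposite.op x ∈ J.asIdealOpposite ^ (n + 1) := by
  induction hx with
  | single ha => simpa [Submodule.pow_one, TwoSidedIdeal.mem_asIdealOpposite] using ha
  | mul ha _ ih =>
    rw [Submodule.pow_succ, MulOpposite.op_mul]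
    exact Ideal.mul_mem_mul ih (TwoSidedIdeal.mem_asIdealOpposite.mpr ha)

theorem TwoSidedIdeal.exists_powEqZero_of_forall_isNilpotent {A : Type*} [Ring A]
    (hart : IsArtinianRing A ∨ IsArtinianRing Aᵐᵒᵖ) {J : TwoSidedIdeal A}
    (hJ : ∀ x ∈ J, IsNilpotent x) : ∃ m, PowEqZero J m := by
  rcases hart with _ | _
  · obtain ⟨n, hn⟩ := IsArtinianRing.isNilpotent_of_forall_isNilpotent (I := J.asIdeal)
      fun x hx ↦ hJ x (TwoSidedIdeal.mem_asIdeal.mp hx)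
    refine ⟨n, fun x hx ↦ ?_⟩
    simpa [hn] using Ideal.pow_le_pow_right n.le_succ hx.mem_pow_asIdeal
  · obtain ⟨n, hn⟩ := IsArtinianRing.isNilpotent_of_forall_isNilpotent (I := J.asIdealOpposite)
      fun x hx ↦ by
        obtain ⟨k, hk⟩ := hJ _ (TwoSidedIdeal.mem_asIdealOpposite.mp hx)
        exact ⟨k, MulOpposite.unop_injective (by simpa using hk)⟩
    refine ⟨n, fun x hx ↦ ?_⟩
    simpa [hn] using Ideal.pow_le_pow_right n.le_succ hx.op_mem_pow_asIdealOpposite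

/-- A completely nilary ring which is left (or right) Artinian is a
nilary ring.  (Right Artinian is expressed as left Artinian of the opposite ring.) -/
theorem nilaryRing_of_completelyNilary_of_artinian
    {A : Type*} [Ring A] (h : IsCompletelyNilaryRing A)
    (hart : IsArtinianRing A ∨ IsArtinianRing Aᵐᵒᵖ) :
    IsNilaryRing A := by
  intro J K hJK
  by_cases hJ : ∀ x ∈ J, IsNilpotent x
  · exact .inl (TwoSidedIdeal.exists_powEqZero_of_forall_isNilpotent hart hJ)
  · push Not at hJ
    obtain ⟨a, haJ, ha⟩ := hJ
    refine .inr (TwoSidedIdeal.exists_powEqZero_of_forall_isNilpotent hart fun b hb ↦ ?_)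
    have hab := h a b (hJK a haJ b hb)
    simp only [isNilpotentElem_iff_isNilpotent] at hab
    exact hab.resolve_left ha
end

section
/- Let A be a completely nilary ring. If A is left (or right) Noetherian, then A is a nilary ring. -/
theorem IsNilpotentElem.isNilpotent {A : Type*} [Ring A] {a : A} (h : IsNilpotentElem a) :
    IsNilpotent a := by
  obtain ⟨n, hn⟩ := h
  exact ⟨n + 1, by rw [← posPow_eq_pow, hn]⟩

theorem IsProdLen.mul_right {A : Type*} [NonUnitalRing A] {S : Set A} {n : ℕ} {x a : A}
    (hx : IsProdLen S n x) (ha : a ∈ S) : IsProdLen S (n + 1) (x * a) := by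
  induction hx with
  | single hb => exact .mul hb (.single ha)
  | mul hb _ ih => rw [mul_assoc]; exact .mul hb ih

theorem IsProdLen.op {A : Type*} [NonUnitalRing A] {S : Set A} {n : ℕ} {x : A}
    (hx : IsProdLen S n x) : IsProdLen (MulOpposite.unop ⁻¹' S) n (MulOpposite.op x) := by
  induction hx with
  | single ha => exact .single ha
  | mul ha _ ih => rw [MulOpposite.op_mul]; exact ih.mul_right ha

/-- Grouping consecutive factors in pairs. -/
theorem IsProdLen.of_mul_mem {A : Type*} [NonUnitalRing A] {S T : Set A}
    (hST : ∀ x ∈ S, ∀ y ∈ S, x * y ∈ T) (n : ℕ) {x : A} (hx : IsProdLen S (2 * n + 1) x) :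
    IsProdLen T n x := by
  induction n generalizing x with
  | zero =>
    obtain _ | ⟨ha, hb⟩ := hx
    obtain hb | _ := hb
    exact .single (hST _ ha _ hb)
  | succ n ih =>
    obtain _ | ⟨ha, hx⟩ := hx
    obtain _ | ⟨hb, hx⟩ := hx
    rw [← mul_assoc]
    exact .mul (hST _ ha _ hb) (ih hx)

/-- If `a * A * a ⊆ P`, then the ideal generated by `P` and `a` has square inside `P`. -/
theorem TwoSidedIdeal.mul_mem_of_mem_span_insert {A : Type*} [Ring A] {P : TwoSidedIdeal A}
    {a : A} (ha : ∀ u, a * u * a ∈ P) {x y : A} (hx : x ∈ span (insert a (P : Set A)))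
    (hy : y ∈ span (insert a (P : Set A))) : x * y ∈ P := by
  have left : ∀ u, a * u * y ∈ P := by
    induction hy using span_induction with
    | mem y hy =>
      obtain rfl | hy := hy
      · exact ha
      · exact fun u => P.mul_mem_left _ _ hy
    | zero => intro u; rw [mul_zero]; exact P.zero_mem
    | add y z _ _ hy hz => intro u; rw [mul_add]; exact P.add_mem (hy u) (hz u)
    | neg y _ hy => intro u; rw [mul_neg]; exact P.neg_mem (hy u)
    | left_absorb r y _ hy => intro u; simpa only [mul_assoc] using hy (u * r)
    | right_absorb r y _ hy => intro u; rw [← mul_assoc]; exact P.mul_mem_right _ _ (hy u)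
  suffices ∀ u, x * u * y ∈ P by simpa using this 1
  induction hx using span_induction with
  | mem x hx =>
    obtain rfl | hx := hx
    · exact left
    · exact fun u => P.mul_mem_right _ _ (P.mul_mem_right _ _ hx)
  | zero => intro u; rw [zero_mul, zero_mul]; exact P.zero_mem
  | add x z _ _ hx hz => intro u; rw [add_mul, add_mul]; exact P.add_mem (hx u) (hz u)
  | neg x _ hx => intro u; rw [neg_mul, neg_mul]; exact P.neg_mem (hx u)
  | left_absorb r x _ hx =>
    intro u; rw [mul_assoc, mul_assoc, ← mul_assoc x]; exact P.mul_mem_left _ _ (hx u)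
  | right_absorb r x _ hx => intro u; rw [mul_assoc x]; exact hx (r * u)

/-- In a left Noetherian ring, a nil ideal `N` not contained in an ideal `P` contains some
`a ∉ P` with `a * A * a ⊆ P`. -/
theorem TwoSidedIdeal.exists_mul_mul_mem_of_nil {A : Type*} [Ring A] [IsNoetherianRing A]
    {N P : TwoSidedIdeal A} (hN : ∀ a ∈ N, IsNilpotent a) (hNP : ¬ N ≤ P) :
    ∃ a ∈ N, a ∉ P ∧ ∀ u, a * u * a ∈ P := by
  let l (a : A) : Ideal A := Submodule.comap (LinearMap.toSpanSingleton A A a) P.asIdeal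
  have mem_l (r a : A) : r ∈ l a ↔ r * a ∈ P := by simp [l]
  obtain ⟨b, hbN, hbP⟩ := SetLike.not_le_iff_exists.mp hNP
  obtain ⟨a, ⟨haN, haP⟩, hmax⟩ :=
    (InvImage.wf l (wellFounded_gt (α := Ideal A))).has_min {a | a ∈ N ∧ a ∉ P} ⟨b, hbN, hbP⟩
  have l_eq (v : A) (hv : a * v ∉ P) : l a = l (a * v) := by
    refine eq_of_le_of_not_lt (fun r hr => ?_) (hmax (a * v) ⟨N.mul_mem_right _ _ haN, hv⟩)
    rw [mem_l] at hr ⊢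
    rw [← mul_assoc]
    exact P.mul_mem_right _ _ hr
  refine ⟨a, haN, haP, fun u => ?_⟩
  have key (n : ℕ) (hn : (a * u) ^ (n + 1) ∈ P) : a * u * a ∈ P := by
    induction n with
    | zero => exact P.mul_mem_right _ _ (by simpa using hn)
    | succ n ih =>
      by_cases h : (a * u) ^ (n + 1) ∈ P
      · exact ih h
      · have hpow : (a * u) ^ (n + 1) = a * (u * (a * u) ^ n) := by rw [pow_succ', mul_assoc]
        rw [← mem_l (a * u) a, l_eq _ (hpow ▸ h), mem_l, ← hpow, ← pow_succ']
        exact hn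
  obtain ⟨n, hn⟩ := hN (a * u) (N.mul_mem_right _ _ haN)
  exact key n (by rw [pow_succ, hn, zero_mul]; exact P.zero_mem)

/-- **Levitzki's theorem**: a nil ideal of a left Noetherian ring is nilpotent. -/
theorem TwoSidedIdeal.exists_powEqZero_of_nil {A : Type*} [Ring A] [IsNoetherianRing A]
    {N : TwoSidedIdeal A} (hN : ∀ a ∈ N, IsNilpotent a) : ∃ m, PowEqZero N m := by
  have bot_mem : (⊥ : TwoSidedIdeal A) ∈ {P | P ≤ N ∧ ∃ m, PowEqZero P m} := by
    refine ⟨bot_le, 0, fun x hx => ?_⟩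
    obtain hx | _ := hx
    exact (mem_bot A).mp hx
  obtain ⟨P, ⟨hPN, m, hm⟩, hmax⟩ :=
    (InvImage.wf asIdeal (wellFounded_gt (α := Ideal A))).has_min _ ⟨_, bot_mem⟩
  by_cases hNP : N ≤ P
  · exact ⟨m, le_antisymm hPN hNP ▸ hm⟩
  obtain ⟨a, haN, haP, ha⟩ := exists_mul_mul_mem_of_nil hN hNP
  refine absurd ?_ (hmax (span (insert a (P : Set A))) ⟨?_, 2 * m + 1, fun x hx => ?_⟩)
  · exact SetLike.lt_iff_le_and_exists.mpr ⟨fun x hx => subset_span (Or.inr hx),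
      a, subset_span (Or.inl rfl), haP⟩
  · exact span_le.mpr (Set.insert_subset haN hPN)
  · exact hm x (hx.of_mul_mem (fun _ hx _ hy => mul_mem_of_mem_span_insert ha hx hy))

/-- **Levitzki's theorem** for right Noetherian rings. -/
theorem TwoSidedIdeal.exists_powEqZero_of_nil_of_op {A : Type*} [Ring A]
    [IsNoetherianRing Aᵐᵒᵖ] {N : TwoSidedIdeal A} (hN : ∀ a ∈ N, IsNilpotent a) :
    ∃ m, PowEqZero N m := by
  obtain ⟨m, hm⟩ := exists_powEqZero_of_nil (N := N.op) fun a ha => by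
    obtain ⟨n, hn⟩ := hN _ (mem_op_iff.mp ha)
    exact ⟨n, MulOpposite.unop_injective (by simpa using hn)⟩
  exact ⟨m, fun x hx => MulOpposite.op_injective (hm _ (coe_op (I := N) ▸ hx.op))⟩

/-- A completely nilary ring which is left (or right) Noetherian is a
nilary ring.  (Right Noetherian is expressed as left Noetherian of the opposite ring.) -/
theorem nilaryRing_of_completelyNilary_of_noetherian
    {A : Type*} [Ring A] (h : IsCompletelyNilaryRing A)
    (hnoeth : IsNoetherianRing A ∨ IsNoetherianRing Aᵐᵒᵖ) :
    IsNilaryRing A := by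
  intro J K hJK
  have nilpotent_of_nil (N : TwoSidedIdeal A) (hN : ∀ a ∈ N, IsNilpotent a) :
      ∃ m, PowEqZero N m := by
    obtain _ | _ := hnoeth
    · exact N.exists_powEqZero_of_nil hN
    · exact N.exists_powEqZero_of_nil_of_op hN
  by_cases hJ : ∀ a ∈ J, IsNilpotentElem a
  · exact .inl (nilpotent_of_nil J fun a ha => (hJ a ha).isNilpotent)
  · push Not at hJ
    obtain ⟨a, haJ, ha⟩ := hJ
    exact .inr (nilpotent_of_nil K fun b hb =>
      ((h a b (hJK a haJ b hb)).resolve_left ha).isNilpotent)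
end

section
/- Let A be a p-nilary ring. If the sum of any collection of nilpotent (two-sided) ideals of A is nilpotent, then A is a nilary ring. -/
theorem IsProdLen.mono {A : Type*} [NonUnitalRing A] {S T : Set A} (hST : S ⊆ T) {n : ℕ} {x : A}
    (hx : IsProdLen S n x) : IsProdLen T n x := by
  induction hx with
  | single ha => exact .single (hST ha)
  | mul ha _ ih => exact .mul (hST ha) ih

theorem PowEqZero.mono {A : Type*} [NonUnitalRing A] {I J : TwoSidedIdeal A} (hIJ : I ≤ J) {m : ℕ}
    (hJ : PowEqZero J m) : PowEqZero I m :=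
  fun x hx => hJ x (hx.mono fun _ ha => hIJ ha)

theorem ProdEqZero.mono {A : Type*} [NonUnitalRing A] {I J K L : TwoSidedIdeal A}
    (hIJ : I ≤ J) (hKL : K ≤ L) (hJL : ProdEqZero J L) : ProdEqZero I K :=
  fun x hx y hy => hJL x (hIJ hx) y (hKL hy)

theorem TwoSidedIdeal.span_singleton_le {A : Type*} [NonUnitalRing A] {J : TwoSidedIdeal A} {a : A}
    (ha : a ∈ J) : TwoSidedIdeal.span {a} ≤ J :=
  TwoSidedIdeal.span_le.2 (Set.singleton_subset_iff.2 ha)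

theorem TwoSidedIdeal.le_sSup_span_singleton {A : Type*} [NonUnitalRing A] (J : TwoSidedIdeal A) :
    J ≤ sSup ((fun a : A => TwoSidedIdeal.span {a}) '' (J : Set A)) :=
  fun a ha => le_sSup (Set.mem_image_of_mem (fun a : A => TwoSidedIdeal.span {a}) ha)
    (TwoSidedIdeal.subset_span (Set.mem_singleton a))

/-- If sums of nilpotent ideals are nilpotent, then an ideal all of whose elements generate
nilpotent ideals is nilpotent. -/
theorem exists_powEqZero_of_forall_span_singleton {A : Type*} [NonUnitalRing A]
    (hsum : ∀ S : Set (TwoSidedIdeal A), (∀ J ∈ S, ∃ m : ℕ, PowEqZero J m) →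
      ∃ m : ℕ, PowEqZero (sSup S) m)
    {J : TwoSidedIdeal A} (hJ : ∀ a ∈ J, ∃ m : ℕ, PowEqZero (TwoSidedIdeal.span {a}) m) :
    ∃ m : ℕ, PowEqZero J m := by
  obtain ⟨m, hm⟩ := hsum _ (Set.forall_mem_image.2 hJ)
  exact ⟨m, hm.mono J.le_sSup_span_singleton⟩

/-- If `A` is a p-nilary ring in which the sum of any collection of
nilpotent two-sided ideals is nilpotent, then `A` is a nilary ring. -/
theorem nilaryRing_of_pNilary_of_sum_nilpotent
    {A : Type*} [NonUnitalRing A] (h : IsPNilaryRing A)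
    (hsum : ∀ S : Set (TwoSidedIdeal A), (∀ J ∈ S, ∃ m : ℕ, PowEqZero J m) →
      ∃ m : ℕ, PowEqZero (sSup S) m) :
    IsNilaryRing A := by
  intro J K hJK
  by_cases hJ : ∀ a ∈ J, ∃ m : ℕ, PowEqZero (TwoSidedIdeal.span {a}) m
  · exact .inl (exists_powEqZero_of_forall_span_singleton hsum hJ)
  · obtain ⟨a, ha, hna⟩ : ∃ a ∈ J, ¬ ∃ m : ℕ, PowEqZero (TwoSidedIdeal.span {a}) m := by
      simpa only [not_forall, exists_prop] using hJ
    refine .inr (exists_powEqZero_of_forall_span_singleton hsum fun b hb => ?_)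
    exact (h a b (hJK.mono (TwoSidedIdeal.span_singleton_le ha)
      (TwoSidedIdeal.span_singleton_le hb))).resolve_left hna
end

section
/- Let I be a weakly nilary (two-sided) ideal of a ring A. Then either I² = 0 or I is a nilary ideal of A. -/
theorem PowLE.mono_left {A : Type*} [NonUnitalRing A] {J K I : TwoSidedIdeal A} (hJK : J ≤ K)
    {m : ℕ} (h : PowLE K m I) : PowLE J m I :=
  fun x hx => h x (hx.mono fun _ ha => hJK ha)

theorem ProdLE.sup_sup {A : Type*} [NonUnitalRing A] {J K I : TwoSidedIdeal A}
    (h : ProdLE J K I) : ProdLE (J ⊔ I) (K ⊔ I) I := by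
  intro x hx y hy
  obtain ⟨a, ha, b, hb, rfl⟩ := TwoSidedIdeal.mem_sup.1 hx
  obtain ⟨c, hc, d, hd, rfl⟩ := TwoSidedIdeal.mem_sup.1 hy
  rw [add_mul, mul_add]
  exact I.add_mem (I.add_mem (h a ha c hc) (I.mul_mem_left a d hd)) (I.mul_mem_right b _ hb)

/-- If `I` is a weakly nilary two-sided ideal of `A`, then `I ^ 2 = 0`
or `I` is a nilary ideal of `A`. -/
theorem sq_eq_zero_or_nilary_of_weaklyNilary
    {A : Type*} [NonUnitalRing A] (I : TwoSidedIdeal A) (hI : IsWeaklyNilaryIdeal I) :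
    ProdEqZero I I ∨ IsNilaryIdeal I := by
  refine or_iff_not_imp_left.2 fun hsq J K hJK => ?_
  have hne : ¬ ProdEqZero (J ⊔ I) (K ⊔ I) := fun h0 => hsq fun x hx y hy =>
    h0 x (TwoSidedIdeal.mem_sup_right hx) y (TwoSidedIdeal.mem_sup_right hy)
  exact (hI.2 _ _ hne hJK.sup_sup).imp
    (Exists.imp fun _ => PowLE.mono_left le_sup_left)
    (Exists.imp fun _ => PowLE.mono_left le_sup_left)
end
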